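/- Let λ₀ satisfy λ₀‖ε‖_n ≥ ‖Xᵀε‖_∞/n, let η := √2 − 1, suppose λη > λ₀ and ‖β⁰‖₁ ≤ ‖ε‖_n·(λη − λ₀)/(2λ₀λ), let 0 ≤ δ < 1, and set L := (λη + λ₀ + δ(λη − λ₀)) / ((1−δ)(λη − λ₀)). Then for every β ∈ ℝᵖ with active set S := S_β such that φ̂(L,S) > 0, the square-root Lasso β̂ satisfies 2δ(λη − λ₀)‖ε‖_n‖β̂−β⁰‖₁ + ‖X(β̂−β⁰)‖_n² ≤ 2δ(λη − λ₀)‖ε‖_n‖β−β⁰‖₁ + ‖X(β−β⁰)‖_n² + ((λη + λ₀ + δ(λη−λ₀))/η)²·((λη+λ₀)/(2λ₀))²·‖ε‖_n²·|S| / φ̂²(L,S). -/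

import Mathlib

open Finset Matrix

/-- `‖v‖_n = √(vᵀv/n)`. -/
noncomputable def normN {n : ℕ} (v : Fin n → ℝ) : ℝ :=
  Real.sqrt ((∑ i, v i ^ 2) / n)

/-- `ℓ₁`-norm of a vector. -/
noncomputable def l1norm {p : ℕ} (v : Fin p → ℝ) : ℝ := ∑ j, |v j|

/-- `ℓ_∞`-norm of a vector. -/
noncomputable def lsup {p : ℕ} (v : Fin p → ℝ) : ℝ := ⨆ j, |v j|

/-- `β_S`: the vector `β` with entries outside `S` set to zero. -/
def sub0 {p : ℕ} (S : Finset (Fin p)) (β : Fin p → ℝ) : Fin p → ℝ :=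
  fun j => if j ∈ S then β j else 0

/-- The compatibility constant squared `φ̂²(L,S)`. -/
noncomputable def compatSq {n p : ℕ} (X : Matrix (Fin n) (Fin p) ℝ) (L : ℝ)
    (S : Finset (Fin p)) : ℝ :=
  sInf { r | ∃ β : Fin p → ℝ, l1norm (sub0 S β) = 1 ∧ l1norm (sub0 Sᶜ β) ≤ L ∧
    r = S.card * (normN (X.mulVec (sub0 S β) - X.mulVec (sub0 Sᶜ β))) ^ 2 }

/-- The empirical inner product `aᵀb/n`, which induces `normN`. -/
noncomputable def innerN {n : ℕ} (a b : Fin n → ℝ) : ℝ := (∑ i, a i * b i) / n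

lemma normN_nonneg {n : ℕ} (v : Fin n → ℝ) : 0 ≤ normN v := Real.sqrt_nonneg _

lemma normN_sq {n : ℕ} (v : Fin n → ℝ) : normN v ^ 2 = innerN v v := by
  unfold normN innerN
  rw [Real.sq_sqrt (by positivity)]
  simp only [pow_two]

lemma innerN_comm {n : ℕ} (a b : Fin n → ℝ) : innerN a b = innerN b a := by
  simp only [innerN, mul_comm]

lemma innerN_add_left {n : ℕ} (a b c : Fin n → ℝ) :
    innerN (a + b) c = innerN a c + innerN b c := by
  simp only [innerN, Pi.add_apply, add_mul, Finset.sum_add_distrib, add_div]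

lemma innerN_sub_left {n : ℕ} (a b c : Fin n → ℝ) :
    innerN (a - b) c = innerN a c - innerN b c := by
  simp only [innerN, Pi.sub_apply, sub_mul, Finset.sum_sub_distrib, sub_div]

lemma innerN_sub_right {n : ℕ} (a b c : Fin n → ℝ) :
    innerN a (b - c) = innerN a b - innerN a c := by
  simp only [innerN_comm a, innerN_sub_left]

lemma normN_smul_sq {n : ℕ} (s : ℝ) (v : Fin n → ℝ) :
    normN (s • v) ^ 2 = s ^ 2 * normN v ^ 2 := by
  simp only [normN_sq, innerN, Pi.smul_apply, smul_eq_mul, mul_div_assoc', Finset.mul_sum]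
  congr 1
  exact Finset.sum_congr rfl fun i _ => by ring

lemma normN_sub_sq {n : ℕ} (a b : Fin n → ℝ) :
    normN (a - b) ^ 2 = normN a ^ 2 - 2 * innerN a b + normN b ^ 2 := by
  simp only [normN_sq, innerN_sub_left, innerN_sub_right, innerN_comm b a]
  ring

lemma innerN_smul_right {n : ℕ} (s : ℝ) (a b : Fin n → ℝ) :
    innerN a (s • b) = s * innerN a b := by
  simp only [innerN, Pi.smul_apply, smul_eq_mul, mul_div_assoc', Finset.mul_sum]
  congr 1
  exact Finset.sum_congr rfl fun i _ => by ring

lemma innerN_le_mul_normN {n : ℕ} (a b : Fin n → ℝ) :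
    innerN a b ≤ normN a * normN b := by
  refine (le_abs_self _).trans (abs_le_of_sq_le_sq ?_ (mul_nonneg (normN_nonneg a) (normN_nonneg b)))
  rw [mul_pow, normN_sq, normN_sq]
  have h := Finset.sum_mul_sq_le_sq_mul_sq Finset.univ a b
  simp only [innerN, ← pow_two, div_pow, div_mul_div_comm]
  gcongr

lemma l1norm_nonneg {p : ℕ} (v : Fin p → ℝ) : 0 ≤ l1norm v :=
  Finset.sum_nonneg fun _ _ => abs_nonneg _

lemma l1norm_add_le {p : ℕ} (u v : Fin p → ℝ) : l1norm (u + v) ≤ l1norm u + l1norm v := by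
  simp only [l1norm, ← Finset.sum_add_distrib]
  exact Finset.sum_le_sum fun j _ => abs_add_le _ _

lemma l1norm_smul {p : ℕ} (s : ℝ) (v : Fin p → ℝ) : l1norm (s • v) = |s| * l1norm v := by
  simp only [l1norm, Pi.smul_apply, smul_eq_mul, abs_mul, Finset.mul_sum]

lemma l1norm_neg {p : ℕ} (v : Fin p → ℝ) : l1norm (-v) = l1norm v := by
  simp only [l1norm, Pi.neg_apply, abs_neg]

lemma l1norm_sub_le {p : ℕ} (u v : Fin p → ℝ) : l1norm (u - v) ≤ l1norm u + l1norm v := by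
  rw [sub_eq_add_neg, ← l1norm_neg v]
  exact l1norm_add_le _ _

lemma eq_zero_of_l1norm_nonpos {p : ℕ} {v : Fin p → ℝ} (h : l1norm v ≤ 0) : v = 0 := by
  funext j
  have h0 : ∑ j, |v j| = 0 := le_antisymm h (l1norm_nonneg v)
  rw [Finset.sum_eq_zero_iff_of_nonneg fun _ _ => abs_nonneg _] at h0
  exact abs_eq_zero.mp (h0 j (Finset.mem_univ j))

lemma l1norm_sub0_add_compl {p : ℕ} (S : Finset (Fin p)) (v : Fin p → ℝ) :
    l1norm (sub0 S v) + l1norm (sub0 Sᶜ v) = l1norm v := by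
  simp only [l1norm, sub0, ← Finset.sum_add_distrib, Finset.mem_compl]
  refine Finset.sum_congr rfl fun j _ => ?_
  by_cases h : j ∈ S <;> simp [h]

lemma l1norm_sub_l1norm_le {p : ℕ} (S : Finset (Fin p)) (β b : Fin p → ℝ)
    (hS : ∀ j, j ∉ S → β j = 0) :
    l1norm β - l1norm b ≤ l1norm (sub0 S (b - β)) - l1norm (sub0 Sᶜ (b - β)) := by
  simp only [l1norm, sub0, ← Finset.sum_sub_distrib, Finset.mem_compl, Pi.sub_apply]
  refine Finset.sum_le_sum fun j _ => ?_
  by_cases h : j ∈ S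
  · simpa [h, abs_sub_comm] using abs_sub_abs_le_abs_sub (β j) (b j)
  · simp [h, hS j h]

lemma innerN_mulVec_le {n p : ℕ} (X : Matrix (Fin n) (Fin p) ℝ) (ε : Fin n → ℝ)
    (u : Fin p → ℝ) :
    innerN ε (X.mulVec u) ≤ lsup (Xᵀ.mulVec ε) / n * l1norm u := by
  have h1 : ∑ i, ε i * X.mulVec u i = ∑ j, Xᵀ.mulVec ε j * u j := by
    change ε ⬝ᵥ X *ᵥ u = (Xᵀ *ᵥ ε) ⬝ᵥ u
    rw [Matrix.dotProduct_mulVec, Matrix.mulVec_transpose]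
  have h2 : ∑ j, Xᵀ.mulVec ε j * u j ≤ lsup (Xᵀ.mulVec ε) * l1norm u := by
    rw [l1norm, Finset.mul_sum]
    refine Finset.sum_le_sum fun j _ => (le_abs_self _).trans ?_
    rw [abs_mul]
    refine mul_le_mul_of_nonneg_right ?_ (abs_nonneg _)
    exact le_ciSup (f := fun j => |Xᵀ.mulVec ε j|) (Set.finite_range _).bddAbove j
  rw [innerN, h1, div_mul_eq_mul_div]
  gcongr

lemma lsup_nonneg {p : ℕ} (v : Fin p → ℝ) : 0 ≤ lsup v :=
  Real.iSup_nonneg fun _ => abs_nonneg _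

lemma compatSq_mul_sq_le {n p : ℕ} (X : Matrix (Fin n) (Fin p) ℝ) (L : ℝ)
    (S : Finset (Fin p)) (d : Fin p → ℝ)
    (hd : l1norm (sub0 Sᶜ d) ≤ L * l1norm (sub0 S d)) :
    compatSq X L S * l1norm (sub0 S d) ^ 2 ≤ S.card * normN (X.mulVec d) ^ 2 := by
  rcases (l1norm_nonneg (sub0 S d)).eq_or_lt with h0 | h0
  · rw [← h0]
    simp only [ne_eq, OfNat.ofNat_ne_zero, not_false_eq_true, zero_pow, mul_zero]
    positivity
  set a := l1norm (sub0 S d) with ha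
  let b : Fin p → ℝ := fun j => if j ∈ S then a⁻¹ * d j else -(a⁻¹ * d j)
  have hbS : sub0 S b = a⁻¹ • sub0 S d := by
    funext j
    by_cases h : j ∈ S <;> simp [sub0, b, h]
  have hbC : sub0 Sᶜ b = -(a⁻¹ • sub0 Sᶜ d) := by
    funext j
    by_cases h : j ∈ S <;> simp [sub0, b, h]
  have hd' : sub0 S b - sub0 Sᶜ b = a⁻¹ • d := by
    funext j
    by_cases h : j ∈ S <;> simp [sub0, b, h]
  have hle : compatSq X L S ≤
      S.card * (normN (X.mulVec (sub0 S b) - X.mulVec (sub0 Sᶜ b))) ^ 2 := by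
    refine csInf_le ⟨0, ?_⟩ ⟨b, ?_, ?_, rfl⟩
    · rintro r ⟨_, _, _, rfl⟩
      positivity
    · rw [hbS, l1norm_smul, abs_of_pos (inv_pos.mpr h0), ← ha, inv_mul_cancel₀ h0.ne']
    · rw [hbC, l1norm_neg, l1norm_smul, abs_of_pos (inv_pos.mpr h0), inv_mul_le_iff₀ h0,
        mul_comm]
      exact hd
  rw [← Matrix.mulVec_sub, hd', Matrix.mulVec_smul, normN_smul_sq] at hle
  calc compatSq X L S * a ^ 2
      ≤ S.card * (a⁻¹ ^ 2 * normN (X.mulVec d) ^ 2) * a ^ 2 := by gcongr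
    _ = S.card * normN (X.mulVec d) ^ 2 := by field_simp

/-- First-order optimality of the square-root Lasso when its residual does not vanish. -/
lemma sqrt_lasso_innerN_le {n p : ℕ} (X : Matrix (Fin n) (Fin p) ℝ) (Y : Fin n → ℝ)
    {lam : ℝ} (hlam : 0 < lam) (b : Fin p → ℝ)
    (hb : ∀ β : Fin p → ℝ,
      normN (Y - X.mulVec b) + lam * l1norm b ≤ normN (Y - X.mulVec β) + lam * l1norm β)
    (hres : 0 < normN (Y - X.mulVec b)) (β : Fin p → ℝ) :
    innerN (Y - X.mulVec b) (X.mulVec (β - b)) ≤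
      lam * normN (Y - X.mulVec b) * (l1norm β - l1norm b) := by
  set a := Y - X.mulVec b with ha
  set v := X.mulVec (β - b) with hv
  have key : ∀ s : ℝ, 0 < s → s ≤ 1 →
      2 * innerN a v - s * normN v ^ 2 ≤ 2 * (lam * normN a * (l1norm β - l1norm b)) := by
    intro s hs hs1
    have h := hb (b + s • (β - b))
    have e : Y - X.mulVec (b + s • (β - b)) = a - s • v := by
      rw [Matrix.mulVec_add, Matrix.mulVec_smul, ha, hv, sub_sub]
    have hl : l1norm (b + s • (β - b)) ≤ (1 - s) * l1norm b + s * l1norm β := by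
      have e2 : b + s • (β - b) = (1 - s) • b + s • β := by
        rw [smul_sub, sub_smul, one_smul]; abel
      rw [e2]
      refine (l1norm_add_le _ _).trans_eq ?_
      rw [l1norm_smul, l1norm_smul, abs_of_nonneg (sub_nonneg.mpr hs1), abs_of_pos hs]
    rw [e] at h
    have hsq := normN_sub_sq a (s • v)
    rw [innerN_smul_right, normN_smul_sq] at hsq
    have h1 : normN a - normN (a - s • v) ≤ s * (lam * (l1norm β - l1norm b)) := by
      nlinarith [mul_le_mul_of_nonneg_left hl hlam.le]
    have h2 := mul_le_mul_of_nonneg_left h1 hres.le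
    refine le_of_mul_le_mul_left ?_ hs
    nlinarith [sq_nonneg (normN a - normN (a - s • v))]
  have lim : Filter.Tendsto (fun s : ℝ => 2 * innerN a v - s * normN v ^ 2)
      (nhdsWithin 0 (Set.Ioi 0)) (nhds (2 * innerN a v - 0 * normN v ^ 2)) :=
    (Continuous.tendsto (by fun_prop) 0).mono_left nhdsWithin_le_nhds
  have := le_of_tendsto lim (by
    filter_upwards [Ioc_mem_nhdsGT (zero_lt_one' ℝ)] with s hs using key s hs.1 hs.2)
  linarith

/-- If the response is orthogonal to every column of `X`, the square-root Lasso is zero. -/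
lemma sqrt_lasso_eq_zero {n p : ℕ} (X : Matrix (Fin n) (Fin p) ℝ) (Y : Fin n → ℝ)
    {lam : ℝ} (hlam : 0 < lam) (b : Fin p → ℝ)
    (hb : ∀ β : Fin p → ℝ,
      normN (Y - X.mulVec b) + lam * l1norm b ≤ normN (Y - X.mulVec β) + lam * l1norm β)
    (hY : lsup (Xᵀ.mulVec Y) / n ≤ 0) : b = 0 := by
  have h := hb 0
  have h0 : l1norm (0 : Fin p → ℝ) = 0 := by simp [l1norm]
  rw [Matrix.mulVec_zero, sub_zero, h0, mul_zero, add_zero] at h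
  have hi := (innerN_mulVec_le X Y b).trans (mul_nonpos_of_nonpos_of_nonneg hY (l1norm_nonneg b))
  have hn : normN Y ≤ normN (Y - X.mulVec b) := by
    refine (le_abs_self _).trans (abs_le_of_sq_le_sq ?_ (normN_nonneg _))
    rw [normN_sub_sq]
    nlinarith [sq_nonneg (normN (X.mulVec b))]
  refine eq_zero_of_l1norm_nonpos ?_
  by_contra! hpos
  nlinarith [mul_pos hlam hpos]

/-- The residual of the square-root Lasso neither overfits nor underfits. -/
lemma sqrt_lasso_residual_bounds {n p : ℕ} (X : Matrix (Fin n) (Fin p) ℝ) (Y : Fin n → ℝ)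
    (β0 : Fin p → ℝ) (ε : Fin n → ℝ) (hε : ε = Y - X.mulVec β0)
    {lam lam0 η : ℝ} (b : Fin p → ℝ)
    (hb : ∀ β : Fin p → ℝ,
      normN (Y - X.mulVec b) + lam * l1norm b ≤ normN (Y - X.mulVec β) + lam * l1norm β)
    (hnoise : lsup (Xᵀ.mulVec ε) / n ≤ lam0 * normN ε)
    (hlam0 : 0 < lam0) (hlam : lam0 < lam) (hη : η ≤ 1) (hεpos : 0 < normN ε)
    (hβ0 : l1norm β0 ≤ normN ε * (lam * η - lam0) / (2 * lam0 * lam)) :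
    (1 - η) * normN ε ≤ normN (Y - X.mulVec b) ∧
      normN (Y - X.mulVec b) ≤ (lam * η + lam0) / (2 * lam0) * normN ε := by
  have hlampos : 0 < lam := hlam0.trans hlam
  have h := hb β0
  rw [← hε] at h
  have hβ0' : 2 * lam0 * (lam * l1norm β0) ≤ normN ε * (lam * η - lam0) := by
    rw [le_div_iff₀ (by positivity)] at hβ0
    linarith
  constructor
  · have hres : Y - X.mulVec b = ε - X.mulVec (b - β0) := by
      rw [hε, Matrix.mulVec_sub]; abel
    have hcs := innerN_le_mul_normN ε (Y - X.mulVec b)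
    rw [hres, innerN_sub_right, ← normN_sq, ← hres] at hcs
    have hho := (innerN_mulVec_le X ε (b - β0)).trans
      (mul_le_mul_of_nonneg_right hnoise (l1norm_nonneg _))
    have hlow : normN ε - lam0 * l1norm (b - β0) ≤ normN (Y - X.mulVec b) := by
      refine le_of_mul_le_mul_left ?_ hεpos
      linarith
    have htri := mul_le_mul_of_nonneg_left (l1norm_sub_le b β0) hlam0.le
    have h1 : lam * (normN ε - lam0 * (l1norm b + l1norm β0)) ≤
        lam * normN (Y - X.mulVec b) := by gcongr; linarith
    have h2 := mul_le_mul_of_nonneg_left h hlam0.le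
    by_contra! hlt
    nlinarith [mul_pos (sub_pos.mpr hlam) (sub_pos.mpr hlt),
      mul_nonneg (mul_nonneg hlam0.le hεpos.le) (sub_nonneg.mpr hη),
      mul_nonneg hlampos.le (l1norm_nonneg b)]
  · rw [div_mul_eq_mul_div, le_div_iff₀ (by positivity)]
    have h2 := mul_le_mul_of_nonneg_left h hlam0.le
    nlinarith [mul_nonneg hlam0.le (mul_nonneg hlampos.le (l1norm_nonneg b))]

lemma two_mul_sub_le_of_cone {A B x y N φ c L : ℝ} (hy : 0 ≤ y) (hN : 0 ≤ N) (hφ : 0 < φ)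
    (hc : 0 < c) (hB : 0 ≤ B) (hcompat : y ≤ L * x → φ * x ^ 2 ≤ c * N)
    (hcone : L * x < y → A * x ≤ B * y) :
    2 * A * x - 2 * B * y - N ≤ A ^ 2 * c / φ := by
  rcases le_or_gt y (L * x) with h | h
  · rw [le_div_iff₀ hφ]
    have h1 : (2 * A * x - N) * φ ≤ A ^ 2 * c := by
      refine le_of_mul_le_mul_left ?_ hc
      nlinarith [mul_le_mul_of_nonneg_left (hcompat h) hφ.le, sq_nonneg (A * c - φ * x)]
    nlinarith [mul_nonneg (mul_nonneg hB hy) hφ.le]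
  · have h1 : 0 ≤ A ^ 2 * c / φ := by positivity
    linarith [hcone h]

set_option maxHeartbeats 1000000 in
theorem sqrt_lasso_ell1_oracle
    {n p : ℕ} (X : Matrix (Fin n) (Fin p) ℝ) (Y : Fin n → ℝ)
    (β0 : Fin p → ℝ) (ε : Fin n → ℝ) (hε : ε = Y - X.mulVec β0)
    (lam : ℝ) (hlam0 : 0 < lam)
    (βhat : Fin p → ℝ)
    (hβhat : ∀ β : Fin p → ℝ,
      normN (Y - X.mulVec βhat) + lam * l1norm βhat ≤
        normN (Y - X.mulVec β) + lam * l1norm β)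
    (lam0 : ℝ) (hlam0' : lam0 * normN ε ≥ lsup (Xᵀ.mulVec ε) / n)
    (η : ℝ) (hη : η = Real.sqrt 2 - 1)
    (hlam : lam * η > lam0)
    (hβ0 : l1norm β0 ≤ normN ε * (lam * η - lam0) / (2 * lam0 * lam))
    (δ : ℝ) (hδ0 : 0 ≤ δ) (hδ1 : δ < 1)
    (L : ℝ)
    (hL : L = (lam * η + lam0 + δ * (lam * η - lam0)) / ((1 - δ) * (lam * η - lam0)))
    (β : Fin p → ℝ) (S : Finset (Fin p)) (hS : ∀ j, j ∈ S ↔ β j ≠ 0)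
    (hφ : 0 < compatSq X L S) :
    2 * δ * (lam * η - lam0) * normN ε * l1norm (βhat - β0) +
        (normN (X.mulVec (βhat - β0))) ^ 2 ≤
      2 * δ * (lam * η - lam0) * normN ε * l1norm (β - β0) +
        (normN (X.mulVec (β - β0))) ^ 2 +
        ((lam * η + lam0 + δ * (lam * η - lam0)) / η) ^ 2 *
          ((lam * η + lam0) / (2 * lam0)) ^ 2 *
          (normN ε) ^ 2 * S.card / compatSq X L S := by
  have hη0 : 0 < η := by
    rw [hη, sub_pos]
    exact Real.lt_sqrt_of_sq_lt (by norm_num)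
  have hη2 : 2 * η ≤ 1 := by
    have : Real.sqrt 2 ≤ 3 / 2 := Real.sqrt_le_iff.mpr (by norm_num)
    linarith
  have hgap : 0 < lam * η - lam0 := sub_pos.mpr hlam
  have hε0 := normN_nonneg ε
  have hsup : 0 ≤ lam0 * normN ε :=
    (div_nonneg (lsup_nonneg _) n.cast_nonneg).trans hlam0'
  by_cases hpos : 0 < lam0 ∧ 0 < normN ε
  swap
  · have hz : lam0 = 0 ∨ normN ε = 0 := by
      by_contra! hne
      have hεp := hε0.lt_of_ne' hne.2
      exact hpos ⟨(nonneg_of_mul_nonneg_left hsup hεp).lt_of_ne' hne.1, hεp⟩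
    have hb0 : β0 = 0 := by
      refine eq_zero_of_l1norm_nonpos (hβ0.trans ?_)
      rcases hz with hz | hz <;> simp [hz]
    have hY : ε = Y := by simp [hε, hb0]
    have hbh : βhat = 0 := by
      refine sqrt_lasso_eq_zero X Y hlam0 βhat hβhat ?_
      rw [← hY]
      refine hlam0'.trans ?_
      rcases hz with hz | hz <;> simp [hz]
    have hl : l1norm (βhat - β0) = 0 := by simp [hbh, hb0, l1norm]
    have hX : normN (X.mulVec (βhat - β0)) = 0 := by simp [hbh, hb0, normN]
    rw [hl, hX]
    have := l1norm_nonneg (β - β0)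
    have hgap' := hgap.le
    simp only [mul_zero, ne_eq, OfNat.ofNat_ne_zero, not_false_eq_true, zero_pow, add_zero]
    positivity
  obtain ⟨hl0, hεp⟩ := hpos
  have hlt : lam0 < lam := by nlinarith
  obtain ⟨hlow, hup⟩ := sqrt_lasso_residual_bounds X Y β0 ε hε βhat hβhat hlam0' hl0 hlt
    (by linarith) hεp hβ0
  have hresη : η * normN ε ≤ normN (Y - X.mulVec βhat) := by nlinarith
  have hres : 0 < normN (Y - X.mulVec βhat) := (mul_pos hη0 hεp).trans_le hresη
  have hkkt := sqrt_lasso_innerN_le X Y hlam0 βhat hβhat hres β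
  have hcone := l1norm_sub_l1norm_le S β βhat fun j hj => by
    by_contra hne
    exact hj ((hS j).mpr hne)
  set d := βhat - β with hd
  set r := normN (Y - X.mulVec βhat) with hr
  set e := normN ε with he
  set x := l1norm (sub0 S d) with hx
  set y := l1norm (sub0 Sᶜ d) with hy
  have hx0 : 0 ≤ x := l1norm_nonneg _
  have hy0 : 0 ≤ y := l1norm_nonneg _
  have hxy : x + y = l1norm d := l1norm_sub0_add_compl S d
  have hnoise : innerN ε (X.mulVec d) ≤ lam0 * e * (x + y) := by
    rw [hxy]
    exact (innerN_mulVec_le X ε d).trans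
      (mul_le_mul_of_nonneg_right hlam0' (l1norm_nonneg _))
  have hpyth : normN (X.mulVec (β - β0)) ^ 2 = normN (X.mulVec (βhat - β0)) ^ 2 -
      2 * innerN (X.mulVec (βhat - β0)) (X.mulVec d) + normN (X.mulVec d) ^ 2 := by
    rw [← normN_sub_sq, ← Matrix.mulVec_sub, hd]
    congr 3
    abel
  have hinner : innerN (Y - X.mulVec βhat) (X.mulVec (β - βhat)) =
      innerN (X.mulVec (βhat - β0)) (X.mulVec d) - innerN ε (X.mulVec d) := by
    have e1 : Y - X.mulVec βhat = ε - X.mulVec (βhat - β0) := by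
      rw [hε, Matrix.mulVec_sub]; abel
    have e2 : X.mulVec (β - βhat) = (-1 : ℝ) • X.mulVec d := by
      rw [← Matrix.mulVec_smul, hd, neg_one_smul, neg_sub]
    rw [e1, e2, innerN_smul_right, innerN_sub_left]
    ring
  have hkkt' : innerN (X.mulVec (βhat - β0)) (X.mulVec d) ≤
      lam * r * (x - y) + lam0 * e * (x + y) := by
    have := mul_le_mul_of_nonneg_left hcone (mul_nonneg hlam0.le hres.le)
    linarith
  have htri : l1norm (βhat - β0) ≤ l1norm (β - β0) + (x + y) := by
    have : βhat - β0 = (β - β0) + d := by rw [hd]; abel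
    rw [this, hxy]
    exact l1norm_add_le _ _
  have htri' := mul_le_mul_of_nonneg_left htri
    (mul_nonneg (mul_nonneg hδ0 hgap.le) hε0)
  set g := lam * η - lam0 with hg
  set A := lam * r + lam0 * e + δ * g * e with hA
  have hA0 : 0 ≤ A := by positivity
  set U := (lam * η + lam0) / (2 * lam0) with hU
  have hU1 : 1 ≤ U := by
    rw [hU, le_div_iff₀ (by positivity)]
    linarith
  set K := lam * η + lam0 + δ * g with hK
  have hK0 : 0 < K := by positivity
  have hAK : A ≤ K / η * U * e := by
    have hsplit : K / η * U * e = lam * (U * e) + (lam0 + δ * g) * e * (U / η) := by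
      rw [hK]; field_simp; ring
    have h1 : 1 ≤ U / η := by
      rw [le_div_iff₀ hη0]
      linarith
    have h2 : (lam0 + δ * g) * e ≤ (lam0 + δ * g) * e * (U / η) :=
      le_mul_of_one_le_right (by positivity) h1
    rw [hsplit, hA]
    nlinarith [mul_le_mul_of_nonneg_left hup hlam0.le]
  have hrem : 2 * A * x - 2 * (lam * r - lam0 * e - δ * g * e) * y -
      normN (X.mulVec d) ^ 2 ≤
        (K / η) ^ 2 * U ^ 2 * e ^ 2 * S.card / compatSq X L S := by
    have hlamr : lam * (η * e) ≤ lam * r := mul_le_mul_of_nonneg_left hresη hlam0.le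
    have hB : (1 - δ) * g * e ≤ lam * r - lam0 * e - δ * g * e := by
      rw [hg]; linarith
    have hgδ : 0 < (1 - δ) * g := mul_pos (sub_pos.mpr hδ1) hgap
    have hc0 : (0 : ℝ) < S.card := by
      rcases S.eq_empty_or_nonempty with hS0 | hS0
      · simp [compatSq, hS0, l1norm, sub0] at hφ
      · exact_mod_cast hS0.card_pos
    have hconeB : L * x < y → A * x ≤ (lam * r - lam0 * e - δ * g * e) * y := by
      intro hc
      have hLx : K * x ≤ (1 - δ) * g * y := by
        rw [hL, div_mul_eq_mul_div, div_lt_iff₀ hgδ] at hc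
        linarith
      have hKδ : (1 - δ) * g ≤ K := by
        have := mul_nonneg hδ0 hgap.le
        linarith
      have hxy' : x ≤ y :=
        le_of_mul_le_mul_left ((mul_le_mul_of_nonneg_right hKδ hx0).trans hLx) hgδ
      have h1 := mul_le_mul_of_nonneg_right hLx hεp.le
      have h2 := mul_nonneg (sub_nonneg.mpr hlamr) (sub_nonneg.mpr hxy')
      have hAe : A = K * e + (lam * r - lam * (η * e)) := by rw [hA, hK]; ring
      have hBe : lam * r - lam0 * e - δ * g * e =
          (1 - δ) * g * e + (lam * r - lam * (η * e)) := by rw [hg]; ring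
      rw [hAe, hBe]
      linarith
    refine (two_mul_sub_le_of_cone hy0 (sq_nonneg _) hφ hc0
      ((by positivity : 0 ≤ (1 - δ) * g * e).trans hB)
      (compatSq_mul_sq_le X L S d) hconeB).trans ?_
    rw [← mul_pow, ← mul_pow]
    gcongr
  rw [hA] at hrem
  linarith
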